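/- arXiv:2411.05097 — 6 statements merged into one kernel-verified Lean document; each statement's English description precedes it below -/
import Mathlib

section
/- Single-point extension inequality: let T and S be disjoint nonempty finite subsets of a metric space with |T| ≥ 2, and let x ∈ T. Then avg(x, (T∪S)∖{x}) ≤ avg(x, T∖{x}) + (|S|/(|T|+|S|−1)) · avg(T,S). -/
open Finset

/-- Average distance between two finite sets of points. -/
noncomputable def avgD {X : Type*} (d : X → X → ℝ) (A B : Finset X) : ℝ :=
  (∑ a ∈ A, ∑ b ∈ B, d a b) / ((A.card : ℝ) * (B.card : ℝ))

/-- Summed triangle inequality through all points of `T`. -/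
theorem card_mul_sum_dist_le {X : Type*} [PseudoMetricSpace X] (T S : Finset X) (x : X) :
    (T.card : ℝ) * ∑ b ∈ S, dist x b
      ≤ (S.card : ℝ) * ∑ a ∈ T, dist x a + ∑ a ∈ T, ∑ b ∈ S, dist a b := by
  calc (T.card : ℝ) * ∑ b ∈ S, dist x b = ∑ _a ∈ T, ∑ b ∈ S, dist x b := by simp
    _ ≤ ∑ a ∈ T, ∑ b ∈ S, (dist x a + dist a b) :=
        sum_le_sum fun a _ => sum_le_sum fun b _ => dist_triangle x a b
    _ = (S.card : ℝ) * ∑ a ∈ T, dist x a + ∑ a ∈ T, ∑ b ∈ S, dist a b := by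
        simp [sum_add_distrib, mul_sum]

/-- Single-point extension inequality: let `T`, `S` be disjoint nonempty finite subsets of a
metric space with `|T| ≥ 2`, and `x ∈ T`. Then
`avg(x, (T∪S)∖{x}) ≤ avg(x, T∖{x}) + (|S|/(|T|+|S|−1)) · avg(T,S)`. -/
theorem avg_single_point_extension {X : Type*} [MetricSpace X] [DecidableEq X]
    (T S : Finset X) (hT : 2 ≤ T.card) (hS : S.Nonempty) (hTS : Disjoint T S)
    (x : X) (hx : x ∈ T) :
    avgD dist {x} ((T ∪ S).erase x)
      ≤ avgD dist {x} (T.erase x)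
        + ((S.card : ℝ) / ((T.card : ℝ) + (S.card : ℝ) - 1)) * avgD dist T S := by
  have hxS : x ∉ S := disjoint_left.mp hTS hx
  have herase : (T ∪ S).erase x = T.erase x ∪ S := by
    rw [erase_union_distrib, erase_eq_of_notMem hxS]
  have hdisj : Disjoint (T.erase x) S := hTS.mono_left (erase_subset x T)
  have hsum : ∑ a ∈ T.erase x, dist x a = ∑ a ∈ T, dist x a := sum_erase T (dist_self x)
  have hcard : ((T.erase x).card : ℝ) = T.card - 1 := by
    rw [card_erase_of_mem hx, Nat.cast_pred (by omega)]
  have hP : 0 ≤ ∑ a ∈ T, dist x a := sum_nonneg fun a _ => dist_nonneg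
  have key := card_mul_sum_dist_le T S x
  have ht : (2 : ℝ) ≤ T.card := by exact_mod_cast hT
  have hs : (0 : ℝ) < S.card := by exact_mod_cast hS.card_pos
  unfold avgD
  rw [herase, sum_singleton, sum_singleton, sum_union hdisj, card_union_of_disjoint hdisj, hsum,
    card_singleton]
  push_cast
  rw [hcard]
  generalize ∑ a ∈ T, dist x a = P at *
  generalize ∑ b ∈ S, dist x b = Q at *
  generalize ∑ a ∈ T, ∑ b ∈ S, dist a b = R at *
  generalize (T.card : ℝ) = t at *
  generalize (S.card : ℝ) = s at *
  have ht₀ : 0 < t := by linarith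
  have ht₁ : 0 < t - 1 := by linarith
  have hn : 0 < t + s - 1 := by linarith
  have hQ : Q ≤ s * P / (t - 1) + R / t := by
    calc Q ≤ (s * P + R) / t := by rw [le_div_iff₀ ht₀]; linarith
      _ = s * P / t + R / t := add_div _ _ _
      _ ≤ s * P / (t - 1) + R / t := by gcongr; linarith
  calc (P + Q) / (1 * (t - 1 + s)) = (P + Q) / (t + s - 1) := by ring_nf
    _ ≤ (P + (s * P / (t - 1) + R / t)) / (t + s - 1) := by gcongr
    _ = P / (1 * (t - 1)) + s / (t + s - 1) * (R / (t * s)) := by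
      field_simp
      ring
end

section
/- For every execution of average-link on a finite symmetric dissimilarity space (no triangle inequality assumed), every k, every cluster S of the k-clustering A^k with |S| ≥ 2, and every pair of distinct clusters T, U of A^k, one has avg(S) ≤ avg(T,U). In particular, whenever sep_min(A^k) > 0, cs-ratio_AV(A^k) ≤ 1. -/
open Finset

/-- Average pairwise distance within a finite set (sum over unordered pairs divided by
`C(|A|,2)`; for symmetric `d` this equals the sum over `A.offDiag` divided by `2·C(|A|,2)`). -/
noncomputable def avgS {X : Type*} [DecidableEq X] (d : X → X → ℝ) (A : Finset X) : ℝ :=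
  (∑ p ∈ A.offDiag, d p.1 p.2) / (2 * (A.card.choose 2 : ℝ))

/-- `sep_min(𝒞) = min_{A ≠ B ∈ 𝒞} avg(A,B)`. -/
noncomputable def sepMin {X : Type*} (d : X → X → ℝ) (𝒞 : Finset (Finset X)) : ℝ :=
  sInf {r : ℝ | ∃ A ∈ 𝒞, ∃ B ∈ 𝒞, A ≠ B ∧ r = avgD d A B}

/-- `max-avg(𝒞) = max {avg(C) : C ∈ 𝒞, |C| ≥ 2}` (and `0` if all clusters are singletons,
since `sSup ∅ = 0` in `ℝ`). -/
noncomputable def maxAvg {X : Type*} [DecidableEq X] (d : X → X → ℝ)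
    (𝒞 : Finset (Finset X)) : ℝ :=
  sSup {r : ℝ | ∃ C ∈ 𝒞, 2 ≤ C.card ∧ r = avgS d C}

/-- An execution of average-link on a finite space with dissimilarity `d`:
`part n` is the partition into `n` singletons and, for `1 ≤ k < n`, `part k` is obtained
from `part (k+1)` by merging two distinct clusters minimizing `avgD d`. -/
structure AvgLinkExec (X : Type*) [Fintype X] [DecidableEq X] (d : X → X → ℝ) where
  part : ℕ → Finset (Finset X)
  init : part (Fintype.card X) = Finset.univ.image (fun x : X => ({x} : Finset X))
  merge : ∀ k : ℕ, 1 ≤ k → k < Fintype.card X →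
    ∃ A ∈ part (k + 1), ∃ B ∈ part (k + 1), A ≠ B ∧
      (∀ A' ∈ part (k + 1), ∀ B' ∈ part (k + 1), A' ≠ B' → avgD d A B ≤ avgD d A' B') ∧
      part k = insert (A ∪ B) (((part (k + 1)).erase A).erase B)

/-- A family of pairwise disjoint nonempty clusters for which `m` separates the averages within
clusters from the averages between clusters, stated without division. -/
structure IsAvgSeparated {X : Type*} [DecidableEq X] (d : X → X → ℝ) (𝒞 : Finset (Finset X))
    (m : ℝ) : Prop where
  nonempty : ∀ S ∈ 𝒞, S.Nonempty
  disjoint : ∀ S ∈ 𝒞, ∀ T ∈ 𝒞, S ≠ T → Disjoint S T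
  within_le : ∀ S ∈ 𝒞, ∑ a ∈ S, ∑ b ∈ S, d a b ≤ m * ((S.card : ℝ) * ((S.card : ℝ) - 1))
  le_between : ∀ T ∈ 𝒞, ∀ U ∈ 𝒞, T ≠ U →
    m * ((T.card : ℝ) * (U.card : ℝ)) ≤ ∑ a ∈ T, ∑ b ∈ U, d a b

theorem sum_sum_swap_of_symm {X : Type*} {d : X → X → ℝ} (hsymm : ∀ x y, d x y = d y x)
    (A B : Finset X) : ∑ a ∈ A, ∑ b ∈ B, d a b = ∑ b ∈ B, ∑ a ∈ A, d b a := by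
  rw [Finset.sum_comm]
  exact Finset.sum_congr rfl fun b _ => Finset.sum_congr rfl fun a _ => hsymm a b

theorem card_mul_card_pos {X : Type*} {A B : Finset X} (hA : A.Nonempty) (hB : B.Nonempty) :
    0 < (A.card : ℝ) * (B.card : ℝ) :=
  mul_pos (Nat.cast_pos.2 hA.card_pos) (Nat.cast_pos.2 hB.card_pos)

theorem avgS_eq_sum_sum_div {X : Type*} [DecidableEq X] {d : X → X → ℝ} (hrefl : ∀ x, d x x = 0)
    (S : Finset X) :
    avgS d S = (∑ a ∈ S, ∑ b ∈ S, d a b) / ((S.card : ℝ) * ((S.card : ℝ) - 1)) := by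
  have hdiag : ∑ p ∈ S.diag, d p.1 p.2 = 0 :=
    Finset.sum_eq_zero fun p hp => by
      rw [← (Finset.mem_diag.1 hp).2]
      exact hrefl p.1
  have hsplit : ∑ p ∈ S.offDiag, d p.1 p.2 = ∑ a ∈ S, ∑ b ∈ S, d a b := by
    rw [← Finset.sum_product' S S d, ← Finset.diag_union_offDiag,
      Finset.sum_union (Finset.disjoint_diag_offDiag S), hdiag, zero_add]
  rw [avgS, hsplit, Nat.cast_choose_two]
  congr 1
  ring

namespace IsAvgSeparated

variable {X : Type*} [DecidableEq X] {d : X → X → ℝ} {𝒞 : Finset (Finset X)} {m : ℝ}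

theorem avgS_le (h : IsAvgSeparated d 𝒞 m) (hrefl : ∀ x, d x x = 0) {S : Finset X} (hS : S ∈ 𝒞)
    (hcard : 2 ≤ S.card) : avgS d S ≤ m := by
  have hc : (2 : ℝ) ≤ S.card := by exact_mod_cast hcard
  rw [avgS_eq_sum_sum_div hrefl, div_le_iff₀ (by nlinarith)]
  exact h.within_le S hS

theorem le_avgD (h : IsAvgSeparated d 𝒞 m) {T U : Finset X} (hT : T ∈ 𝒞) (hU : U ∈ 𝒞)
    (hTU : T ≠ U) : m ≤ avgD d T U := by
  rw [avgD, le_div_iff₀ (card_mul_card_pos (h.nonempty T hT) (h.nonempty U hU))]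
  exact h.le_between T hT U hU hTU

theorem singletons [Fintype X] (hnonneg : ∀ x y, 0 ≤ d x y) (hrefl : ∀ x, d x x = 0) :
    IsAvgSeparated d (Finset.univ.image fun x : X => ({x} : Finset X)) 0 where
  nonempty := by simp
  disjoint := by simp [eq_comm]
  within_le := by simp [hrefl]
  le_between := by simp [hnonneg]

/-- Merging a pair of clusters at minimum average distance keeps the family separated, now at the
average distance of the merged pair. -/
theorem merge (h : IsAvgSeparated d 𝒞 m) (hsymm : ∀ x y, d x y = d y x) {A B : Finset X}
    (hA : A ∈ 𝒞) (hB : B ∈ 𝒞) (hAB : A ≠ B)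
    (hmin : ∀ A' ∈ 𝒞, ∀ B' ∈ 𝒞, A' ≠ B' → avgD d A B ≤ avgD d A' B') :
    IsAvgSeparated d (insert (A ∪ B) ((𝒞.erase A).erase B)) (avgD d A B) := by
  have hdisj := h.disjoint A hA B hB hAB
  have hcard : ((A ∪ B).card : ℝ) = A.card + B.card := by
    rw [Finset.card_union_of_disjoint hdisj, Nat.cast_add]
  have hm : m ≤ avgD d A B := h.le_avgD hA hB hAB
  have hsum : ∑ a ∈ A, ∑ b ∈ B, d a b = avgD d A B * ((A.card : ℝ) * (B.card : ℝ)) := by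
    rw [avgD, div_mul_cancel₀ _ (card_mul_card_pos (h.nonempty A hA) (h.nonempty B hB)).ne']
  have hbetween : ∀ T ∈ 𝒞, ∀ U ∈ 𝒞, T ≠ U →
      avgD d A B * ((T.card : ℝ) * (U.card : ℝ)) ≤ ∑ a ∈ T, ∑ b ∈ U, d a b := by
    intro T hT U hU hTU
    rw [← le_div_iff₀ (card_mul_card_pos (h.nonempty T hT) (h.nonempty U hU))]
    exact hmin T hT U hU hTU
  have hwithin : ∀ S ∈ 𝒞,
      ∑ a ∈ S, ∑ b ∈ S, d a b ≤ avgD d A B * ((S.card : ℝ) * ((S.card : ℝ) - 1)) := by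
    intro S hS
    have hc : (1 : ℝ) ≤ S.card := by exact_mod_cast (h.nonempty S hS).card_pos
    exact (h.within_le S hS).trans
      (mul_le_mul_of_nonneg_right hm (mul_nonneg (by linarith) (by linarith)))
  have hmerged : ∀ U ∈ 𝒞, U ≠ A → U ≠ B →
      avgD d A B * (((A ∪ B).card : ℝ) * (U.card : ℝ)) ≤ ∑ a ∈ A ∪ B, ∑ b ∈ U, d a b := by
    intro U hU hUA hUB
    rw [Finset.sum_union hdisj, hcard]
    linarith [hbetween A hA U hU hUA.symm, hbetween B hB U hU hUB.symm]
  have hmem : ∀ S, S ∈ insert (A ∪ B) ((𝒞.erase A).erase B) ↔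
      S = A ∪ B ∨ (S ≠ B ∧ S ≠ A ∧ S ∈ 𝒞) := by
    simp
  refine ⟨fun S hS => ?_, fun S hS T hT hST => ?_, fun S hS => ?_, fun T hT U hU hTU => ?_⟩
  · rcases (hmem S).1 hS with rfl | ⟨-, -, hS⟩
    · exact (h.nonempty A hA).mono Finset.subset_union_left
    · exact h.nonempty S hS
  · rcases (hmem S).1 hS with rfl | ⟨hSB, hSA, hS⟩ <;>
      rcases (hmem T).1 hT with rfl | ⟨hTB, hTA, hT⟩
    · exact absurd rfl hST
    · exact Finset.disjoint_union_left.2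
        ⟨h.disjoint A hA T hT hTA.symm, h.disjoint B hB T hT hTB.symm⟩
    · exact Finset.disjoint_union_right.2 ⟨h.disjoint S hS A hA hSA, h.disjoint S hS B hB hSB⟩
    · exact h.disjoint S hS T hT hST
  · rcases (hmem S).1 hS with rfl | ⟨-, -, hS⟩
    · rw [hcard]
      simp only [Finset.sum_union hdisj, Finset.sum_add_distrib]
      rw [← sum_sum_swap_of_symm hsymm A B, hsum]
      linarith [hwithin A hA, hwithin B hB]
    · exact hwithin S hS
  · rcases (hmem T).1 hT with rfl | ⟨hTB, hTA, hT⟩ <;>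
      rcases (hmem U).1 hU with rfl | ⟨hUB, hUA, hU⟩
    · exact absurd rfl hTU
    · exact hmerged U hU hUA hUB
    · rw [sum_sum_swap_of_symm hsymm, mul_comm (T.card : ℝ)]
      exact hmerged T hT hTA hTB
    · exact hbetween T hT U hU hTU

end IsAvgSeparated

theorem AvgLinkExec.exists_isAvgSeparated {X : Type*} [Fintype X] [DecidableEq X]
    {d : X → X → ℝ} (hsymm : ∀ x y, d x y = d y x) (hnonneg : ∀ x y, 0 ≤ d x y)
    (hrefl : ∀ x, d x x = 0) (E : AvgLinkExec X d) {k : ℕ} (hk1 : 1 ≤ k)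
    (hkn : k ≤ Fintype.card X) : ∃ m, IsAvgSeparated d (E.part k) m := by
  induction hkn using Nat.decreasingInduction with
  | self => exact ⟨0, E.init ▸ IsAvgSeparated.singletons hnonneg hrefl⟩
  | of_succ k hk ih =>
    obtain ⟨m, hm⟩ := ih (Nat.le_add_left 1 k)
    obtain ⟨A, hA, B, hB, hAB, hmin, hpart⟩ := E.merge k hk1 hk
    exact ⟨avgD d A B, hpart ▸ hm.merge hsymm hA hB hAB hmin⟩

/-- For every execution of average-link on a finite symmetric dissimilarity space, every `k`,
every cluster `S` of `A^k` with `|S| ≥ 2` and all distinct clusters `T`, `U` of `A^k`,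
`avg(S) ≤ avg(T,U)`; in particular, whenever `sep_min(A^k) > 0`, `cs-ratio_AV(A^k) ≤ 1`. -/
theorem avgLink_csRatioAV_le_one {X : Type*} [Fintype X] [DecidableEq X] (d : X → X → ℝ)
    (hsymm : ∀ x y, d x y = d y x) (hnonneg : ∀ x y, 0 ≤ d x y) (hrefl : ∀ x, d x x = 0)
    (E : AvgLinkExec X d) (k : ℕ) (hk1 : 1 ≤ k) (hkn : k ≤ Fintype.card X) :
    (∀ S ∈ E.part k, 2 ≤ S.card → ∀ T ∈ E.part k, ∀ U ∈ E.part k, T ≠ U →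
        avgS d S ≤ avgD d T U) ∧
    (0 < sepMin d (E.part k) → maxAvg d (E.part k) / sepMin d (E.part k) ≤ 1) := by
  obtain ⟨m, hm⟩ := E.exists_isAvgSeparated hsymm hnonneg hrefl hk1 hkn
  refine ⟨fun S hS hcard T hT U hU hTU =>
    (hm.avgS_le hrefl hS hcard).trans (hm.le_avgD hT hU hTU), fun hpos => ?_⟩
  rw [div_le_one hpos]
  have hne : {r : ℝ | ∃ A ∈ E.part k, ∃ B ∈ E.part k, A ≠ B ∧ r = avgD d A B}.Nonempty := by
    by_contra hempty
    rw [sepMin, Set.not_nonempty_iff_eq_empty.1 hempty, Real.sInf_empty] at hpos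
    exact lt_irrefl 0 hpos
  refine Real.sSup_le ?_ hpos.le
  rintro _ ⟨S, hS, hcard, rfl⟩
  refine le_csInf hne ?_
  rintro _ ⟨T, hT, U, hU, hTU, rfl⟩
  exact (hm.avgS_le hrefl hS hcard).trans (hm.le_avgD hT hU hTU)
end

section
/- Let X, Y, Z be clusters of the k-clustering A^k produced by an execution of average-link on a finite metric space, with |X| ≥ 2 and Y ≠ Z. Then for every x ∈ X, avg(x,X) ≤ avg(x, X∖{x}) ≤ H_{|X|−1} · avg(Y,Z). -/
open Finset

/-- The `p`-th harmonic number `H_p = Σ_{i=1}^p 1/i` (with `H_0 = 0`). -/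
noncomputable def harmonicR (p : ℕ) : ℝ := ∑ i ∈ Finset.range p, (1 : ℝ) / (i + 1)

theorem avgD_comm {X : Type*} [MetricSpace X] (A B : Finset X) :
    avgD dist A B = avgD dist B A := by
  unfold avgD
  rw [Finset.sum_comm, mul_comm (A.card : ℝ)]
  simp only [dist_comm]

theorem avgD_nonneg {X : Type*} [MetricSpace X] (A B : Finset X) : 0 ≤ avgD dist A B := by
  unfold avgD
  positivity

theorem le_avgD_iff {X : Type*} {d : X → X → ℝ} {A B : Finset X} (hA : A.Nonempty)
    (hB : B.Nonempty) {m : ℝ} :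
    m ≤ avgD d A B ↔ m * ((A.card : ℝ) * (B.card : ℝ)) ≤ ∑ a ∈ A, ∑ b ∈ B, d a b := by
  have hA' : (0 : ℝ) < A.card := by exact_mod_cast hA.card_pos
  have hB' : (0 : ℝ) < B.card := by exact_mod_cast hB.card_pos
  exact le_div_iff₀ (by positivity)

theorem le_avgD_union {X : Type*} [DecidableEq X] {d : X → X → ℝ} {A B C : Finset X}
    (hA : A.Nonempty) (hB : B.Nonempty) (hC : C.Nonempty) (hAB : Disjoint A B) {m : ℝ}
    (hAC : m ≤ avgD d A C) (hBC : m ≤ avgD d B C) : m ≤ avgD d (A ∪ B) C := by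
  rw [le_avgD_iff hA hC] at hAC
  rw [le_avgD_iff hB hC] at hBC
  rw [le_avgD_iff (hA.mono Finset.subset_union_left) hC, Finset.sum_union hAB,
    Finset.card_union_of_disjoint hAB]
  push_cast
  linarith

theorem harmonicR_nonneg (p : ℕ) : 0 ≤ harmonicR p := by
  unfold harmonicR
  positivity

/-- Each of the `b` terms separating `H_p` from `H_{p+b}` is at least `1/(p+b)`. -/
theorem mul_harmonicR_add_le (p b : ℕ) :
    ((p + b : ℕ) : ℝ) * harmonicR p + b ≤ ((p + b : ℕ) : ℝ) * harmonicR (p + b) := by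
  unfold harmonicR
  rw [Finset.sum_range_add, mul_add]
  gcongr
  · rw [Finset.mul_sum]
    calc (b : ℝ) = ∑ _i ∈ Finset.range b, (1 : ℝ) := by simp
      _ ≤ _ := by
        refine Finset.sum_le_sum fun i hi => ?_
        have hib : ((i + 1 : ℕ) : ℝ) ≤ b := by exact_mod_cast Finset.mem_range.1 hi
        push_cast at hib ⊢
        rw [mul_one_div, one_le_div (by positivity)]
        linarith

/-- The triangle inequality through the points of `A`, averaged over `A` and summed over `B`. -/
theorem card_mul_sum_dist_le_s5 {X : Type*} [MetricSpace X] {A B : Finset X} (hA : A.Nonempty)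
    (hB : B.Nonempty) (x : X) :
    (A.card : ℝ) * ∑ b ∈ B, dist x b ≤
      (B.card : ℝ) * ∑ a ∈ A, dist x a + avgD dist A B * ((A.card : ℝ) * (B.card : ℝ)) := by
  have hA' : (0 : ℝ) < A.card := by exact_mod_cast hA.card_pos
  have hB' : (0 : ℝ) < B.card := by exact_mod_cast hB.card_pos
  rw [avgD, div_mul_cancel₀ _ (by positivity)]
  calc (A.card : ℝ) * ∑ b ∈ B, dist x b = ∑ _a ∈ A, ∑ b ∈ B, dist x b := by simp
    _ ≤ ∑ a ∈ A, ∑ b ∈ B, (dist x a + dist a b) :=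
      Finset.sum_le_sum fun a _ => Finset.sum_le_sum fun b _ => dist_triangle x a b
    _ = _ := by simp [Finset.sum_add_distrib, Finset.mul_sum]

theorem sum_dist_union_le {X : Type*} [MetricSpace X] [DecidableEq X] {A B : Finset X}
    (hA : A.Nonempty) (hB : B.Nonempty) (hAB : Disjoint A B) {x : X}
    (h : ∑ y ∈ A, dist x y ≤
      ((A.card - 1 : ℕ) : ℝ) * harmonicR (A.card - 1) * avgD dist A B) :
    ∑ y ∈ A ∪ B, dist x y ≤
      (((A ∪ B).card - 1 : ℕ) : ℝ) * harmonicR ((A ∪ B).card - 1) * avgD dist A B := by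
  have htri := card_mul_sum_dist_le_s5 hA hB x
  have hm := avgD_nonneg A B
  rw [Finset.sum_union hAB, Finset.card_union_of_disjoint hAB]
  obtain ⟨p, hp⟩ : ∃ p, A.card = p + 1 := ⟨A.card - 1, by have := hA.card_pos; omega⟩
  rw [hp] at h htri ⊢
  rw [show p + 1 + B.card - 1 = p + B.card by omega]
  rw [Nat.add_sub_cancel] at h
  have hH := mul_le_mul_of_nonneg_right (mul_harmonicR_add_le p B.card) hm
  refine le_trans ?_ hH
  push_cast at h htri ⊢
  have hp0 : (0 : ℝ) < p + 1 := by positivity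
  have hslack : 0 ≤ (B.card : ℝ) * (harmonicR p * avgD dist A B) :=
    mul_nonneg (Nat.cast_nonneg _) (mul_nonneg (harmonicR_nonneg p) hm)
  have hscaled := mul_le_mul_of_nonneg_left h (by positivity : (0 : ℝ) ≤ p + 1 + B.card)
  refine le_of_mul_le_mul_left ?_ hp0
  linarith

/-- The invariant maintained by average-link: the clusters are nonempty and pairwise disjoint, and
the total distance from a point to its cluster is controlled by any intercluster average. -/
theorem AvgLinkExec.invariant {X : Type*} [MetricSpace X] [Fintype X] [DecidableEq X]
    (E : AvgLinkExec X dist) (k : ℕ) (hk1 : 1 ≤ k) (hkn : k ≤ Fintype.card X) :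
    (∀ C ∈ E.part k, C.Nonempty) ∧
    (∀ C ∈ E.part k, ∀ D ∈ E.part k, C ≠ D → Disjoint C D) ∧
    ∀ C ∈ E.part k, ∀ x ∈ C, ∀ Y ∈ E.part k, ∀ Z ∈ E.part k, Y ≠ Z →
      ∑ y ∈ C, dist x y ≤ ((C.card - 1 : ℕ) : ℝ) * harmonicR (C.card - 1) * avgD dist Y Z := by
  induction hkn using Nat.decreasingInduction with
  | self =>
    rw [E.init]
    simp only [Finset.mem_image, Finset.mem_univ, true_and, forall_exists_index,
      forall_apply_eq_imp_iff]
    refine ⟨by simp, fun a b hab => by simpa using hab, ?_⟩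
    simp
  | of_succ k hlt ih =>
    obtain ⟨hne, hdisj, hsum⟩ := ih (by omega)
    obtain ⟨A, hA, B, hB, hAB, hmin, hpart⟩ := E.merge k hk1 hlt
    have hmem : ∀ C ∈ E.part k, C = A ∪ B ∨ (C ∈ E.part (k + 1) ∧ C ≠ A ∧ C ≠ B) := by
      intro C hC
      rw [hpart] at hC
      simp only [Finset.mem_insert, Finset.mem_erase] at hC
      tauto
    have hABd := hdisj A hA B hB hAB
    have hunion : ∀ C ∈ E.part (k + 1), C ≠ A → C ≠ B → avgD dist A B ≤ avgD dist (A ∪ B) C :=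
      fun C hC hCA hCB => le_avgD_union (hne A hA) (hne B hB) (hne C hC) hABd
        (hmin A hA C hC hCA.symm) (hmin B hB C hC hCB.symm)
    refine ⟨?_, ?_, ?_⟩
    · intro C hC
      rcases hmem C hC with rfl | ⟨hC, -, -⟩
      · exact (hne A hA).mono Finset.subset_union_left
      · exact hne C hC
    · intro C hC D hD hCD
      rcases hmem C hC with rfl | ⟨hC, hCA, hCB⟩ <;> rcases hmem D hD with rfl | ⟨hD, hDA, hDB⟩
      · exact absurd rfl hCD
      · exact Finset.disjoint_union_left.2 ⟨hdisj A hA D hD hDA.symm, hdisj B hB D hD hDB.symm⟩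
      · exact Finset.disjoint_union_right.2 ⟨hdisj C hC A hA hCA, hdisj C hC B hB hCB⟩
      · exact hdisj C hC D hD hCD
    · intro C hC x hx Y hY Z hZ hYZ
      have hmono : avgD dist A B ≤ avgD dist Y Z := by
        rcases hmem Y hY with rfl | ⟨hY, hYA, hYB⟩ <;>
          rcases hmem Z hZ with rfl | ⟨hZ, hZA, hZB⟩
        · exact absurd rfl hYZ
        · exact hunion Z hZ hZA hZB
        · rw [avgD_comm Y]
          exact hunion Y hY hYA hYB
        · exact hmin Y hY Z hZ hYZ
      refine le_trans ?_ (mul_le_mul_of_nonneg_left hmono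
        (mul_nonneg (Nat.cast_nonneg _) (harmonicR_nonneg _)))
      rcases hmem C hC with rfl | ⟨hC, -, -⟩
      · rcases Finset.mem_union.1 hx with hxA | hxB
        · exact sum_dist_union_le (hne A hA) (hne B hB) hABd (hsum A hA x hxA A hA B hB hAB)
        · rw [Finset.union_comm, avgD_comm]
          exact sum_dist_union_le (hne B hB) (hne A hA) hABd.symm
            (hsum B hB x hxB B hB A hA hAB.symm)
      · exact hsum C hC x hx A hA B hB hAB

/-- Let `Xc`, `Y`, `Z` be clusters of the `k`-clustering `A^k` produced by average-link on a
finite metric space, with `|Xc| ≥ 2` and `Y ≠ Z`. Then for every `x ∈ Xc`,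
`avg(x,Xc) ≤ avg(x, Xc∖{x}) ≤ H_{|Xc|−1} · avg(Y,Z)`. -/
theorem avgLink_point_avg_bound {X : Type*} [MetricSpace X] [Fintype X] [DecidableEq X]
    (E : AvgLinkExec X dist) (k : ℕ) (hk1 : 1 ≤ k) (hkn : k ≤ Fintype.card X)
    (Xc Y Z : Finset X) (hXc : Xc ∈ E.part k) (hY : Y ∈ E.part k) (hZ : Z ∈ E.part k)
    (hXcard : 2 ≤ Xc.card) (hYZ : Y ≠ Z) (x : X) (hx : x ∈ Xc) :
    avgD dist {x} Xc ≤ avgD dist {x} (Xc.erase x) ∧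
    avgD dist {x} (Xc.erase x) ≤ harmonicR (Xc.card - 1) * avgD dist Y Z := by
  have hsum := (E.invariant k hk1 hkn).2.2 Xc hXc x hx Y hY Z hZ hYZ
  have herase : ∑ y ∈ Xc.erase x, dist x y = ∑ y ∈ Xc, dist x y :=
    Finset.sum_erase _ (dist_self x)
  have hpos : (0 : ℝ) < ((Xc.card - 1 : ℕ) : ℝ) := by
    exact_mod_cast (by omega : 0 < Xc.card - 1)
  simp only [avgD, Finset.sum_singleton, Finset.card_singleton, Nat.cast_one, one_mul, herase,
    Finset.card_erase_of_mem hx] at hsum ⊢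
  constructor
  · gcongr
    omega
  · rw [div_le_iff₀ hpos]
    linarith
end

section
/- Exact recovery by average-link of very well-separated clusterings: if some k-clustering C* of a finite metric space satisfies max-diam(C*) < (1/3)·sep_min(C*), then for every execution of average-link the k-clustering A^k equals C*. -/
open Finset

/-- The diameter of a finite set. -/
noncomputable def diamF {X : Type*} (d : X → X → ℝ) (C : Finset X) : ℝ :=
  sSup {r : ℝ | ∃ x ∈ C, ∃ y ∈ C, r = d x y}

/-- `max-diam(𝒞) = max_{C ∈ 𝒞} diam(C)`. -/
noncomputable def maxDiam {X : Type*} (d : X → X → ℝ) (𝒞 : Finset (Finset X)) : ℝ :=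
  sSup {r : ℝ | ∃ C ∈ 𝒞, r = diamF d C}

/-- A `k`-clustering of `X`: a partition of all points of `X` into `k` nonempty clusters. -/
def IsClustering {X : Type*} (𝒞 : Finset (Finset X)) (k : ℕ) : Prop :=
  𝒞.card = k ∧ (∀ C ∈ 𝒞, C.Nonempty) ∧
    (∀ C ∈ 𝒞, ∀ C' ∈ 𝒞, C ≠ C' → Disjoint C C') ∧ (∀ x : X, ∃ C ∈ 𝒞, x ∈ C)

section AvgD

variable {X : Type*} {d : X → X → ℝ} {A B : Finset X} {c : ℝ}

lemma avgD_le (hA : A.Nonempty) (hB : B.Nonempty) (h : ∀ a ∈ A, ∀ b ∈ B, d a b ≤ c) :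
    avgD d A B ≤ c := by
  have hA' : (0 : ℝ) < A.card := by exact_mod_cast hA.card_pos
  have hB' : (0 : ℝ) < B.card := by exact_mod_cast hB.card_pos
  rw [avgD, div_le_iff₀ (mul_pos hA' hB')]
  calc ∑ a ∈ A, ∑ b ∈ B, d a b ≤ ∑ a ∈ A, ∑ b ∈ B, c :=
        Finset.sum_le_sum fun a ha => Finset.sum_le_sum fun b hb => h a ha b hb
    _ = c * (A.card * B.card) := by simp; ring

lemma lt_avgD (hA : A.Nonempty) (hB : B.Nonempty) (h : ∀ a ∈ A, ∀ b ∈ B, c < d a b) :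
    c < avgD d A B := by
  have hA' : (0 : ℝ) < A.card := by exact_mod_cast hA.card_pos
  have hB' : (0 : ℝ) < B.card := by exact_mod_cast hB.card_pos
  rw [avgD, lt_div_iff₀ (mul_pos hA' hB')]
  calc c * (A.card * B.card) = ∑ a ∈ A, ∑ b ∈ B, c := by simp; ring
    _ < ∑ a ∈ A, ∑ b ∈ B, d a b :=
        Finset.sum_lt_sum_of_nonempty hA fun a ha =>
          Finset.sum_lt_sum_of_nonempty hB fun b hb => h a ha b hb

lemma dist_le_maxDiam {𝒞 : Finset (Finset X)} {C : Finset X} (hC : C ∈ 𝒞) {x y : X}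
    (hx : x ∈ C) (hy : y ∈ C) : d x y ≤ maxDiam d 𝒞 := by
  have hdiam : d x y ≤ diamF d C := by
    refine le_csSup (Set.Finite.bddAbove ?_) ⟨x, hx, y, hy, rfl⟩
    refine ((C ×ˢ C).finite_toSet.image fun p => d p.1 p.2).subset ?_
    rintro r ⟨x, hx, y, hy, rfl⟩
    exact ⟨(x, y), by simp [hx, hy], rfl⟩
  refine hdiam.trans (le_csSup (Set.Finite.bddAbove ?_) ⟨C, hC, rfl⟩)
  refine (𝒞.finite_toSet.image (diamF d)).subset ?_
  rintro r ⟨C, hC, rfl⟩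
  exact ⟨C, hC, rfl⟩

lemma sepMin_le_avgD {𝒞 : Finset (Finset X)} (hA : A ∈ 𝒞) (hB : B ∈ 𝒞) (hne : A ≠ B) :
    sepMin d 𝒞 ≤ avgD d A B := by
  refine csInf_le (Set.Finite.bddBelow ?_) ⟨A, hA, B, hB, hne, rfl⟩
  refine ((𝒞 ×ˢ 𝒞).finite_toSet.image fun p => avgD d p.1 p.2).subset ?_
  rintro r ⟨A, hA, B, hB, -, rfl⟩
  exact ⟨(A, B), by simp [hA, hB], rfl⟩

end AvgD

/-- In a very well-separated clustering, points of different clusters are farther apart than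
the largest diameter. -/
lemma maxDiam_lt_dist {X : Type*} [MetricSpace X] {𝒞 : Finset (Finset X)}
    (hsep : maxDiam dist 𝒞 < (1 / 3) * sepMin dist 𝒞) {C C' : Finset X}
    (hC : C ∈ 𝒞) (hC' : C' ∈ 𝒞) (hne : C ≠ C') {x y : X} (hx : x ∈ C) (hy : y ∈ C') :
    maxDiam dist 𝒞 < dist x y := by
  have havg : avgD dist C C' ≤ dist x y + 2 * maxDiam dist 𝒞 := by
    refine avgD_le ⟨x, hx⟩ ⟨y, hy⟩ fun a ha b hb => ?_
    have hax : dist a x ≤ maxDiam dist 𝒞 := dist_le_maxDiam hC ha hx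
    have hyb : dist y b ≤ maxDiam dist 𝒞 := dist_le_maxDiam hC' hy hb
    linarith [dist_triangle4 a x y b]
  have := sepMin_le_avgD (d := dist) hC hC' hne
  linarith

section Clustering

variable {X : Type*} {P 𝒞 : Finset (Finset X)} {j k : ℕ}

lemma IsClustering.card_le [Fintype X] (hP : IsClustering P k) : k ≤ Fintype.card X := by
  obtain ⟨rfl, hne, hdisj, -⟩ := hP
  choose f hf using hne
  rw [← Fintype.card_coe]
  refine Fintype.card_le_of_injective (fun C : P => f C C.2) fun C C' h => Subtype.ext ?_
  by_contra hCC'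
  refine Finset.disjoint_left.1 (hdisj C C.2 C' C'.2 hCC') (hf C C.2) ?_
  simpa only [h] using hf C' C'.2

lemma isClustering_singletons [Fintype X] [DecidableEq X] :
    IsClustering (Finset.univ.image fun x : X => ({x} : Finset X)) (Fintype.card X) := by
  refine ⟨?_, ?_, ?_, fun x => ⟨{x}, by simp, by simp⟩⟩
  · rw [Finset.card_image_of_injective _ Finset.singleton_injective, Finset.card_univ]
  · simp
  · simp [eq_comm]

lemma IsClustering.merge [DecidableEq X] (hP : IsClustering P (j + 1)) {A B : Finset X}
    (hA : A ∈ P) (hB : B ∈ P) (hAB : A ≠ B) :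
    IsClustering (insert (A ∪ B) ((P.erase A).erase B)) j := by
  obtain ⟨hcard, hne, hdisj, hcov⟩ := hP
  have hrest : ∀ C ∈ (P.erase A).erase B, Disjoint (A ∪ B) C := by
    intro C hC
    simp only [Finset.mem_erase] at hC
    exact Finset.disjoint_union_left.2
      ⟨hdisj A hA C hC.2.2 hC.2.1.symm, hdisj B hB C hC.2.2 hC.1.symm⟩
  refine ⟨?_, ?_, ?_, ?_⟩
  · have hnot : A ∪ B ∉ (P.erase A).erase B := fun h => by
      have := (hne A hA).mono (Finset.subset_union_left (s₂ := B))
      exact this.ne_empty (disjoint_self.1 (hrest _ h))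
    have hB' : B ∈ P.erase A := Finset.mem_erase.2 ⟨hAB.symm, hB⟩
    have h₁ := Finset.card_erase_add_one hA
    have h₂ := Finset.card_erase_add_one hB'
    rw [Finset.card_insert_of_notMem hnot]
    omega
  · intro C hC
    rcases Finset.mem_insert.1 hC with rfl | hC
    · exact (hne A hA).mono Finset.subset_union_left
    · exact hne C (Finset.mem_of_mem_erase (Finset.mem_of_mem_erase hC))
  · intro C hC C' hC' hCC'
    rcases Finset.mem_insert.1 hC with rfl | hC <;> rcases Finset.mem_insert.1 hC' with rfl | hC'
    · exact absurd rfl hCC'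
    · exact hrest C' hC'
    · exact (hrest C hC).symm
    · exact hdisj C (Finset.mem_of_mem_erase (Finset.mem_of_mem_erase hC)) C'
        (Finset.mem_of_mem_erase (Finset.mem_of_mem_erase hC')) hCC'
  · intro x
    obtain ⟨C, hC, hx⟩ := hcov x
    by_cases h : C = A ∨ C = B
    · exact ⟨A ∪ B, Finset.mem_insert_self _ _, by rcases h with rfl | rfl <;> simp [hx]⟩
    · push Not at h
      exact ⟨C, by simp [hC, h.1, h.2], hx⟩

/-- A refinement with the same number of clusters is the clustering itself. -/
lemma IsClustering.eq_of_refines (hP : IsClustering P k) (h𝒞 : IsClustering 𝒞 k)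
    (href : ∀ A ∈ P, ∃ C ∈ 𝒞, A ⊆ C) : P = 𝒞 := by
  obtain ⟨hPcard, hPne, -, hPcov⟩ := hP
  obtain ⟨hcard, hne, hdisj, -⟩ := h𝒞
  choose! f hf hsub using href
  have hmem : ∀ {x A C}, A ∈ P → C ∈ 𝒞 → x ∈ A → x ∈ C → f A = C := by
    intro x A C hA hC hxA hxC
    by_contra h
    exact Finset.disjoint_left.1 (hdisj _ (hf A hA) _ hC h) (hsub A hA hxA) hxC
  have hsurj : Set.SurjOn f P 𝒞 := by
    intro C hC
    obtain ⟨x, hx⟩ := hne C hC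
    obtain ⟨A, hA, hxA⟩ := hPcov x
    exact ⟨A, hA, hmem hA hC hxA hx⟩
  have hinj : Set.InjOn f P :=
    Finset.injOn_of_surjOn_of_card_le f hf hsurj (hPcard.trans hcard.symm).le
  refine Finset.eq_of_subset_of_card_le (fun A hA => ?_) (hcard.trans hPcard.symm).le
  have hfA : f A = A := by
    refine (Finset.Subset.antisymm (hsub A hA) fun x hx => ?_).symm
    obtain ⟨B, hB, hxB⟩ := hPcov x
    rwa [← hinj hB hA (hmem hB (hf A hA) hxB hx)]
  exact hfA ▸ hf A hA

end Clustering

/-- A minimizing pair of a strict refinement of a very well-separated clustering lies in a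
single cluster. -/
lemma union_subset_of_avgD_minimal {X : Type*} [MetricSpace X] [DecidableEq X]
    {P 𝒞 : Finset (Finset X)}
    (hsep : maxDiam dist 𝒞 < (1 / 3) * sepMin dist 𝒞) (hne : ∀ A ∈ P, A.Nonempty)
    (hcard : 𝒞.card < P.card) (href : ∀ A ∈ P, ∃ C ∈ 𝒞, A ⊆ C) {A B : Finset X}
    (hA : A ∈ P) (hB : B ∈ P)
    (hmin : ∀ A' ∈ P, ∀ B' ∈ P, A' ≠ B' → avgD dist A B ≤ avgD dist A' B') :
    ∃ C ∈ 𝒞, A ∪ B ⊆ C := by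
  choose! f hf hsub using href
  obtain ⟨A', hA', B', hB', hne', heq⟩ := Finset.exists_ne_map_eq_of_card_lt_of_maps_to hcard hf
  have hle : avgD dist A B ≤ maxDiam dist 𝒞 :=
    (hmin A' hA' B' hB' hne').trans <| avgD_le (hne A' hA') (hne B' hB') fun a ha b hb =>
      dist_le_maxDiam (hf A' hA') (hsub A' hA' ha) (heq ▸ hsub B' hB' hb)
  have hfAB : f A = f B := by
    by_contra h
    exact hle.not_gt <| lt_avgD (hne A hA) (hne B hB) fun a ha b hb =>
      maxDiam_lt_dist hsep (hf A hA) (hf B hB) h (hsub A hA ha) (hsub B hB hb)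
  exact ⟨f A, hf A hA, Finset.union_subset (hsub A hA) (hfAB ▸ hsub B hB)⟩

/-- Exact recovery by average-link of very well-separated clusterings: if some `k`-clustering
`𝒞` of a finite metric space satisfies `max-diam(𝒞) < (1/3)·sep_min(𝒞)`, then every
execution of average-link produces exactly `𝒞` as its `k`-clustering. -/
theorem avgLink_recovers_well_separated {X : Type*} [MetricSpace X] [Fintype X]
    [DecidableEq X] (k : ℕ) (𝒞 : Finset (Finset X)) (h𝒞 : IsClustering 𝒞 k)
    (hsep : maxDiam dist 𝒞 < (1 / 3) * sepMin dist 𝒞)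
    (E : AvgLinkExec X dist) :
    E.part k = 𝒞 := by
  have hk : k ≠ 0 := by
    rintro rfl
    obtain rfl := Finset.card_eq_zero.1 h𝒞.1
    simp [maxDiam, sepMin] at hsep
  obtain ⟨hP, href⟩ : IsClustering (E.part k) k ∧ ∀ A ∈ E.part k, ∃ C ∈ 𝒞, A ⊆ C := by
    refine Nat.decreasingInduction'
      (P := fun j => IsClustering (E.part j) j ∧ ∀ A ∈ E.part j, ∃ C ∈ 𝒞, A ⊆ C)
      ?_ h𝒞.card_le ?_
    · rintro j hj hkj ⟨hP, href⟩
      obtain ⟨A, hA, B, hB, hAB, hmin, hpart⟩ := E.merge j (by omega) hj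
      rw [hpart]
      refine ⟨hP.merge hA hB hAB, fun D hD => ?_⟩
      rcases Finset.mem_insert.1 hD with rfl | hD
      · refine union_subset_of_avgD_minimal hsep hP.2.1 ?_ href hA hB hmin
        rw [h𝒞.1, hP.1]
        omega
      · exact href D (Finset.mem_of_mem_erase (Finset.mem_of_mem_erase hD))
    · rw [E.init]
      refine ⟨isClustering_singletons, fun A hA => ?_⟩
      obtain ⟨x, -, rfl⟩ := Finset.mem_image.1 hA
      obtain ⟨C, hC, hx⟩ := h𝒞.2.2.2 x
      exact ⟨C, hC, Finset.singleton_subset_iff.2 hx⟩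
  exact hP.eq_of_refines h𝒞 href
end

section
/- Transversal lemma: for every k-clustering C = (C_1, …, C_k) of a finite symmetric dissimilarity space with k ≥ 2, there exists a set of points P ⊆ X with |P| = k and |P ∩ C_i| = 1 for every i, such that avg(P) ≥ sep_av(C). -/
open Finset

/-- `sep_av(𝒞) = (1/C(k,2)) · Σ_{i<j} avg(Cᵢ,Cⱼ)`; for symmetric `d` the sum over
unordered pairs of clusters is half the sum over ordered pairs of distinct clusters. -/
noncomputable def sepAv {X : Type*} [DecidableEq X] (d : X → X → ℝ)
    (𝒞 : Finset (Finset X)) : ℝ :=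
  (∑ C ∈ 𝒞, ∑ C' ∈ 𝒞, if C ≠ C' then avgD d C C' else 0) / (2 * (𝒞.card.choose 2 : ℝ))

/-- Fixing one coordinate divides the number of choice functions by the size of that factor. -/
lemma card_piFinset_update_singleton_mul {ι X : Type*} [Fintype ι] [DecidableEq ι]
    (t : ι → Finset X) (i : ι) (a : X) :
    (Fintype.piFinset (Function.update t i {a})).card * (t i).card =
      (Fintype.piFinset t).card := by
  rw [Fintype.card_piFinset, Fintype.card_piFinset,
    ← Finset.mul_prod_erase univ _ (mem_univ i),
    ← Finset.mul_prod_erase univ (fun x => (t x).card) (mem_univ i)]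
  have h : ∏ x ∈ univ.erase i, (Function.update t i {a} x).card =
      ∏ x ∈ univ.erase i, (t x).card :=
    prod_congr rfl fun x hx => by rw [Function.update_of_ne (ne_of_mem_erase hx)]
  rw [h, Function.update_self, card_singleton, one_mul, mul_comm]

lemma card_filter_piFinset_mul {ι X : Type*} [Fintype ι] [DecidableEq ι] [DecidableEq X]
    (t : ι → Finset X) {i j : ι} (hij : i ≠ j) {a b : X} (ha : a ∈ t i) (hb : b ∈ t j) :
    ((Fintype.piFinset t).filter fun f => f i = a ∧ f j = b).card *
      ((t i).card * (t j).card) = (Fintype.piFinset t).card := by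
  have h : ((Fintype.piFinset t).filter fun f => f i = a ∧ f j = b) =
      Fintype.piFinset (Function.update (Function.update t i {a}) j {b}) := by
    ext f
    simp only [mem_filter, Fintype.mem_piFinset]
    constructor
    · rintro ⟨hf, hfi, hfj⟩ x
      by_cases hxj : x = j
      · subst hxj; simpa using hfj
      · by_cases hxi : x = i
        · subst hxi; simpa [hxj] using hfi
        · simpa [hxj, hxi] using hf x
    · intro hf
      have hfi : f i = a := by simpa [hij] using hf i
      have hfj : f j = b := by simpa using hf j
      refine ⟨fun x => ?_, hfi, hfj⟩
      by_cases hxj : x = j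
      · subst hxj; rwa [hfj]
      · by_cases hxi : x = i
        · subst hxi; rwa [hfi]
        · simpa [hxj, hxi] using hf x
  have h₁ := card_piFinset_update_singleton_mul (Function.update t i {a}) j b
  rw [Function.update_of_ne hij.symm] at h₁
  rw [h, mul_comm (t i).card, ← mul_assoc, h₁, card_piFinset_update_singleton_mul]

/-- Averaging `d (f i) (f j)` over all choice functions `f` gives the average distance
between the factors `t i` and `t j`. -/
lemma sum_piFinset_eq_card_mul_avgD {ι X : Type*} [Fintype ι] [DecidableEq ι] [DecidableEq X]
    (d : X → X → ℝ) (t : ι → Finset X) (ht : ∀ i, (t i).Nonempty) {i j : ι} (hij : i ≠ j) :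
    ∑ f ∈ Fintype.piFinset t, d (f i) (f j) =
      (Fintype.piFinset t).card * avgD d (t i) (t j) := by
  have hi : ((t i).card : ℝ) ≠ 0 := by exact_mod_cast (ht i).card_pos.ne'
  have hj : ((t j).card : ℝ) ≠ 0 := by exact_mod_cast (ht j).card_pos.ne'
  have hmaps : ∀ f ∈ Fintype.piFinset t, (f i, f j) ∈ t i ×ˢ t j := fun f hf =>
    mem_product.2 ⟨Fintype.mem_piFinset.1 hf i, Fintype.mem_piFinset.1 hf j⟩
  rw [← sum_fiberwise_of_maps_to hmaps, avgD, ← sum_product', mul_div_assoc', mul_sum, sum_div]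
  refine sum_congr rfl fun p hp => ?_
  obtain ⟨ha, hb⟩ := mem_product.1 hp
  have hcard := card_filter_piFinset_mul t hij ha hb
  have hsum : ∑ f ∈ Fintype.piFinset t with (f i, f j) = p, d (f i) (f j) =
      ((Fintype.piFinset t).filter fun f => f i = p.1 ∧ f j = p.2).card * d p.1 p.2 := by
    rw [← nsmul_eq_mul, ← sum_const]
    refine sum_congr (filter_congr fun f _ => Prod.ext_iff) fun f hf => ?_
    obtain ⟨-, h₁, h₂⟩ := mem_filter.1 hf
    rw [h₁, h₂]
  rw [hsum, ← hcard]
  push_cast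
  field_simp

/-- Some choice function has total pairwise distance at least the total average distance. -/
lemma exists_mem_piFinset_sum_avgD_le {ι X : Type*} [Fintype ι] [DecidableEq ι] [DecidableEq X]
    (d : X → X → ℝ) (t : ι → Finset X) (ht : ∀ i, (t i).Nonempty) :
    ∃ f ∈ Fintype.piFinset t, (∑ i, ∑ j, if i ≠ j then avgD d (t i) (t j) else 0) ≤
      ∑ i, ∑ j, if i ≠ j then d (f i) (f j) else 0 := by
  apply exists_le_of_sum_le (Fintype.piFinset_nonempty.2 ht)
  apply le_of_eq
  rw [sum_const, nsmul_eq_mul, mul_sum, sum_comm]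
  refine sum_congr rfl fun i _ => ?_
  rw [mul_sum, sum_comm]
  refine sum_congr rfl fun j _ => ?_
  by_cases hij : i = j
  · simp [hij]
  · simpa [hij] using (sum_piFinset_eq_card_mul_avgD d t ht hij).symm

lemma sum_offDiag_image_of_injective {ι X : Type*} [Fintype ι] [DecidableEq ι] [DecidableEq X]
    (d : X → X → ℝ) {f : ι → X} (hf : Function.Injective f) :
    ∑ p ∈ (univ.image f).offDiag, d p.1 p.2 =
      ∑ i, ∑ j, if i ≠ j then d (f i) (f j) else 0 := by
  have h : (univ.image f).offDiag =
      (univ.image f ×ˢ univ.image f).filter fun p => p.1 ≠ p.2 := by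
    ext p; simp [mem_offDiag, and_assoc]
  rw [h, sum_filter, sum_product, sum_image hf.injOn]
  refine sum_congr rfl fun i _ => ?_
  rw [sum_image hf.injOn]
  simp only [hf.ne_iff]

/-- Transversal lemma: for every `k`-clustering `𝒞` of a finite symmetric dissimilarity
space with `k ≥ 2`, there is a set `P` of `k` points meeting every cluster in exactly one
point such that `avg(P) ≥ sep_av(𝒞)`. -/
theorem exists_transversal_avg_ge_sepAv {X : Type*} [Fintype X] [DecidableEq X]
    (d : X → X → ℝ)
    (hsymm : ∀ x y, d x y = d y x) (hnonneg : ∀ x y, 0 ≤ d x y) (hrefl : ∀ x, d x x = 0)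
    (k : ℕ) (hk : 2 ≤ k) (𝒞 : Finset (Finset X)) (h𝒞 : IsClustering 𝒞 k) :
    ∃ P : Finset X, P.card = k ∧ (∀ C ∈ 𝒞, (P ∩ C).card = 1) ∧
      sepAv d 𝒞 ≤ avgS d P := by
  obtain ⟨hcard, hne, hdisj, -⟩ := h𝒞
  obtain ⟨f, hf, hle⟩ := exists_mem_piFinset_sum_avgD_le d (fun C : 𝒞 => C.1)
    fun C => hne C.1 C.2
  have hmem : ∀ C : 𝒞, f C ∈ C.1 := Fintype.mem_piFinset.1 hf
  have huniq : ∀ C C' : 𝒞, f C ∈ C'.1 → C = C' := fun C C' h => by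
    by_contra hCC'
    exact disjoint_left.1 (hdisj C.1 C.2 C'.1 C'.2 (Subtype.coe_ne_coe.2 hCC')) (hmem C) h
  have hinj : Function.Injective f := fun C C' h => huniq C C' (h ▸ hmem C')
  have hP : (univ.image f).card = k := by
    rw [card_image_of_injective _ hinj, card_univ, Fintype.card_coe, hcard]
  refine ⟨univ.image f, hP, fun C hC => card_eq_one.2 ⟨f ⟨C, hC⟩, ?_⟩, ?_⟩
  · ext x
    simp only [mem_inter, mem_image, mem_univ, true_and, mem_singleton]
    constructor
    · rintro ⟨⟨C', rfl⟩, hx⟩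
      rw [huniq C' ⟨C, hC⟩ hx]
    · rintro rfl
      exact ⟨⟨_, rfl⟩, hmem ⟨C, hC⟩⟩
  · rw [sepAv, avgS, hP, hcard, sum_offDiag_image_of_injective d hinj]
    refine div_le_div_of_nonneg_right (le_trans (le_of_eq ?_) hle) (by positivity)
    rw [← sum_coe_sort 𝒞]
    refine sum_congr rfl fun C _ => ?_
    rw [← sum_coe_sort 𝒞]
    simp only [ne_eq, Subtype.ext_iff]
end

section
/- For every k with 2 ≤ k ≤ n, there exists a set of points P ⊆ X with |P| = k and avg(P) ≥ OPT_SEP(k), where OPT_SEP(k) is the maximum of sep_av over all k-clusterings of X. -/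
open Finset

/-- Replacing one set of a family by each of its singletons in turn preserves, on average, every
average distance between two distinct members of the family. -/
theorem sum_avgD_update_singleton {X ι : Type*} [DecidableEq ι] (d : X → X → ℝ)
    (B : ι → Finset X) {i₀ i j : ι} (h₀ : (B i₀).Nonempty) (hij : i ≠ j) :
    ∑ a ∈ B i₀, avgD d (Function.update B i₀ {a} i) (Function.update B i₀ {a} j) =
      (B i₀).card * avgD d (B i) (B j) := by
  have hc : ((B i₀).card : ℝ) ≠ 0 := by exact_mod_cast h₀.card_pos.ne'
  rcases eq_or_ne i i₀ with rfl | hi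
  · simp only [Function.update_self, Function.update_of_ne hij.symm, avgD, sum_singleton,
      card_singleton, Nat.cast_one, one_mul, ← sum_div]
    rw [← mul_div_assoc, mul_div_mul_left _ _ hc]
  · rcases eq_or_ne j i₀ with rfl | hj
    · simp only [Function.update_self, Function.update_of_ne hi, avgD, sum_singleton,
        card_singleton, Nat.cast_one, mul_one, ← sum_div]
      rw [sum_comm, mul_comm ((B i).card : ℝ), ← mul_div_assoc, mul_div_mul_left _ _ hc]
    · simp [Function.update_of_ne hi, Function.update_of_ne hj]

/-- The members of a family indexed by `t ⊆ s` can be shrunk to singletons without decreasing the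
total average distance between distinct members. -/
theorem exists_singletons_sum_avgD_ge {X ι : Type*} [DecidableEq ι] (d : X → X → ℝ)
    (s : Finset ι) (A : ι → Finset X) (hA : ∀ i ∈ s, (A i).Nonempty)
    (t : Finset ι) (hts : t ⊆ s) :
    ∃ B : ι → Finset X, (∀ i ∈ s, B i ⊆ A i ∧ (B i).Nonempty) ∧ (∀ i ∈ t, ∃ x, B i = {x}) ∧
      (∑ i ∈ s, ∑ j ∈ s, if i ≠ j then avgD d (A i) (A j) else 0) ≤
        ∑ i ∈ s, ∑ j ∈ s, if i ≠ j then avgD d (B i) (B j) else 0 := by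
  induction t using Finset.induction_on with
  | empty => exact ⟨A, fun i hi => ⟨Subset.rfl, hA i hi⟩, by simp, le_rfl⟩
  | insert i₀ t hi₀ ih =>
    obtain ⟨B, hB, hBt, hle⟩ := ih fun i hi => hts (mem_insert_of_mem hi)
    have h₀ := (hB i₀ (hts (mem_insert_self _ _))).2
    have key : ∑ _a ∈ B i₀, (∑ i ∈ s, ∑ j ∈ s, if i ≠ j then avgD d (B i) (B j) else 0) ≤
        ∑ a ∈ B i₀, ∑ i ∈ s, ∑ j ∈ s, if i ≠ j then
          avgD d (Function.update B i₀ {a} i) (Function.update B i₀ {a} j) else 0 := by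
      refine le_of_eq ?_
      rw [sum_const, nsmul_eq_mul, mul_sum, sum_comm]
      refine sum_congr rfl fun i _ => ?_
      rw [mul_sum, sum_comm]
      refine sum_congr rfl fun j _ => ?_
      by_cases hij : i = j
      · simp [hij]
      · simp only [ne_eq, hij, not_false_eq_true, if_true]
        exact (sum_avgD_update_singleton d B h₀ hij).symm
    obtain ⟨a, ha, hale⟩ := exists_le_of_sum_le h₀ key
    refine ⟨Function.update B i₀ {a}, fun i hi => ?_, fun i hi => ?_, hle.trans hale⟩
    · rcases eq_or_ne i i₀ with rfl | hne
      · simpa using (hB i hi).1 ha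
      · simpa [Function.update_of_ne hne] using hB i hi
    · rcases eq_or_ne i i₀ with rfl | hne
      · exact ⟨a, by simp⟩
      · simpa [Function.update_of_ne hne] using hBt i ((mem_insert.1 hi).resolve_left hne)

/-- Some choice of one point per cluster has average distance at least `sepAv`. -/
theorem exists_points_avgS_ge_sepAv {X : Type*} [DecidableEq X] [Nonempty X] (d : X → X → ℝ)
    {𝒞 : Finset (Finset X)} {k : ℕ} (h𝒞 : IsClustering 𝒞 k) :
    ∃ P : Finset X, P.card = k ∧ sepAv d 𝒞 ≤ avgS d P := by
  obtain ⟨hcard, hne, hdisj, -⟩ := h𝒞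
  obtain ⟨B, hB, hBs, hle⟩ := exists_singletons_sum_avgD_ge d 𝒞 id hne 𝒞 Subset.rfl
  choose! f hf using hBs
  have hmem : ∀ C ∈ 𝒞, f C ∈ C := fun C hC => (hB C hC).1 (by simp [hf C hC])
  have hinj : Set.InjOn f 𝒞 := fun C hC C' hC' h => by
    by_contra hCC
    exact disjoint_left.1 (hdisj C hC C' hC' hCC) (hmem C hC) (h ▸ hmem C' hC')
  have hPcard : (𝒞.image f).card = 𝒞.card := card_image_of_injOn hinj
  refine ⟨𝒞.image f, hPcard.trans hcard, ?_⟩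
  have hsum : ∑ p ∈ (𝒞.image f).offDiag, d p.1 p.2 =
      ∑ C ∈ 𝒞, ∑ C' ∈ 𝒞, if C ≠ C' then avgD d (B C) (B C') else 0 := by
    have hoff : (𝒞.image f).offDiag =
        (𝒞.image f ×ˢ 𝒞.image f).filter fun p => p.1 ≠ p.2 := by
      ext p; simp [mem_offDiag, and_assoc]
    rw [hoff, sum_filter, sum_product, sum_image hinj]
    refine sum_congr rfl fun C hC => ?_
    rw [sum_image hinj]
    refine sum_congr rfl fun C' hC' => ?_
    simp [hf C hC, hf C' hC', avgD, hinj.eq_iff hC hC']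
  rw [sepAv, avgS, hPcard, hsum]
  exact div_le_div_of_nonneg_right hle (by positivity)

/-- For every `k` with `2 ≤ k ≤ n`, there is a set `P ⊆ X` of `k` points with
`avg(P) ≥ OPT_SEP(k)`, where `OPT_SEP(k)` is the maximum of `sep_av` over all
`k`-clusterings of `X`. -/
theorem exists_points_avg_ge_optSep {X : Type*} [Fintype X] [DecidableEq X]
    (d : X → X → ℝ)
    (hsymm : ∀ x y, d x y = d y x) (hnonneg : ∀ x y, 0 ≤ d x y) (hrefl : ∀ x, d x x = 0)
    (k : ℕ) (hk2 : 2 ≤ k) (hkn : k ≤ Fintype.card X) :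
    ∃ P : Finset X, P.card = k ∧
      sSup {r : ℝ | ∃ 𝒞 : Finset (Finset X), IsClustering 𝒞 k ∧ r = sepAv d 𝒞}
        ≤ avgS d P := by
  have : Nonempty X := Fintype.card_pos_iff.1 (by omega)
  obtain ⟨P, hP, hmax⟩ := exists_max_image (powersetCard k (univ : Finset X)) (avgS d)
    (powersetCard_nonempty.2 (by simpa using hkn))
  refine ⟨P, (mem_powersetCard.1 hP).2, Real.sSup_le ?_ ?_⟩
  · rintro r ⟨𝒞, h𝒞, rfl⟩
    obtain ⟨Q, hQ, hle⟩ := exists_points_avgS_ge_sepAv d h𝒞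
    exact hle.trans (hmax Q (mem_powersetCard.2 ⟨subset_univ _, hQ⟩))
  · exact div_nonneg (sum_nonneg fun p _ => hnonneg _ _) (by positivity)
end
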